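/- arXiv:1501.00673 — 3 statements merged into one kernel-verified Lean document; each statement's English description precedes it below -/
import Mathlib

section
/- For each ℓ ∈ L and each pair (x,y) ∈ X², there exists a coupling ϱ_ℓ^{x,y} ∈ C(π_ℓ^x, π_ℓ^y) such that: (a) for each B ∈ B(Ξ²), the map X² ∋ (x,y) ↦ ϱ_ℓ^{x,y}(B) is measurable with respect to the product σ-field F_ℓ ⊗ F_ℓ; and (b) d(π_ℓ^x, π_ℓ^y) = ∫_{Ξ²} υ(ξ,η) ϱ_ℓ^{x,y}(dξ,dη). -/
open MeasureTheory ENNReal Filter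
open scoped Classical ENNReal

namespace DP

noncomputable section

variable {L Ξ : Type*}

/-- The discrete "metric" `υ`, valued in `ℝ≥0∞`. -/
def ups {α : Type*} (a b : α) : ℝ≥0∞ := if a = b then 0 else 1

/-- The discrete "metric" `υ`, valued in `ℝ`. -/
def upsR {α : Type*} (a b : α) : ℝ := if a = b then 0 else 1

/-- The sub-σ-field of the product σ-field generated by the coordinates outside `D`. -/
def extCyl [MeasurableSpace Ξ] (D : Set L) : MeasurableSpace (L → Ξ) :=
  MeasurableSpace.comap (fun (x : L → Ξ) (i : (Dᶜ : Set L)) => x i.1) MeasurableSpace.pi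

/-- `F_ℓ`: the sub-σ-field generated by the coordinates indexed by `L ∖ {ℓ}`. -/
def Floc [MeasurableSpace Ξ] (ℓ : L) : MeasurableSpace (L → Ξ) := extCyl {ℓ}

/-- The product σ-field `F_ℓ ⊗ F_ℓ` on `X²`. -/
def FlocPair [MeasurableSpace Ξ] (ℓ : L) : MeasurableSpace ((L → Ξ) × (L → Ξ)) :=
  (Floc ℓ).comap Prod.fst ⊔ (Floc ℓ).comap Prod.snd

/-- The total variation distance between two measures. -/
def tvDist {E : Type*} [MeasurableSpace E] (σ ς : Measure E) : ℝ :=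
  ⨆ A : {A : Set E // MeasurableSet A}, |(σ A.1).toReal - (ς A.1).toReal|

/-- `ν` is a coupling of `μ1` and `μ2`. -/
def IsCoupling {E F : Type*} [MeasurableSpace E] [MeasurableSpace F]
    (ν : Measure (E × F)) (μ1 : Measure E) (μ2 : Measure F) : Prop :=
  ν.map Prod.fst = μ1 ∧ ν.map Prod.snd = μ2

/-- A one-site specification: a family of probability measures `π ℓ x` on `Ξ`
such that `x ↦ π ℓ x A` is `F_ℓ`-measurable. -/
structure IsSpecification [MeasurableSpace Ξ] (π : L → (L → Ξ) → Measure Ξ) : Prop where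
  prob : ∀ ℓ x, IsProbabilityMeasure (π ℓ x)
  meas : ∀ (ℓ : L) (A : Set Ξ), MeasurableSet A → Measurable[Floc ℓ] fun x => π ℓ x A

/-- Consistency of `μ` with the one-site specification `π` (equation (5) of the paper). -/
def Consistent [MeasurableSpace Ξ] (π : L → (L → Ξ) → Measure Ξ)
    (μ : Measure (L → Ξ)) : Prop :=
  ∀ (ℓ : L) (A : Set (L → Ξ)), MeasurableSet A →
    μ A = ∫⁻ y, π ℓ y {ξ : Ξ | Function.update y ℓ ξ ∈ A} ∂μ

/-- `μ(h) = sup_ℓ ∫ h(x_ℓ) dμ`. -/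
def Mh [MeasurableSpace Ξ] (h : Ξ → ℝ) (μ : Measure (L → Ξ)) : ℝ≥0∞ :=
  ⨆ ℓ : L, ∫⁻ x, ENNReal.ofReal (h (x ℓ)) ∂μ

/-- `ν(I_ℓ)`. -/
def nuI [MeasurableSpace Ξ] (ν : Measure ((L → Ξ) × (L → Ξ))) (ℓ : L) : ℝ≥0∞ :=
  ∫⁻ p, ups (p.1 ℓ) (p.2 ℓ) ∂ν

/-- `ν(I_ℓ H^i_{ℓ'})`, `i = 0,1` standing for the components `1,2`. -/
def nuIH [MeasurableSpace Ξ] (h : Ξ → ℝ) (ν : Measure ((L → Ξ) × (L → Ξ)))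
    (i : Fin 2) (ℓ ℓ' : L) : ℝ≥0∞ :=
  ∫⁻ p, ups (p.1 ℓ) (p.2 ℓ) * ENNReal.ofReal (h ((if i = 0 then p.1 else p.2) ℓ')) ∂ν

/-- `γ(ν) = sup_ℓ ν(I_ℓ)`. -/
def gam [MeasurableSpace Ξ] (ν : Measure ((L → Ξ) × (L → Ξ))) : ℝ≥0∞ := ⨆ ℓ : L, nuI ν ℓ

/-- `λ(ν) = max_i sup_{ℓ,ℓ'} ν(I_ℓ H^i_{ℓ'})`. -/
def lam [MeasurableSpace Ξ] (h : Ξ → ℝ) (ν : Measure ((L → Ξ) × (L → Ξ))) : ℝ≥0∞ :=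
  ⨆ i : Fin 2, ⨆ ℓ : L, ⨆ ℓ' : L, nuIH h ν i ℓ ℓ'

/-- `γ_D(ν) = sup_{ℓ ∈ D} ν(I_ℓ)`. -/
def gamD [MeasurableSpace Ξ] (ν : Measure ((L → Ξ) × (L → Ξ))) (D : Set L) : ℝ≥0∞ :=
  ⨆ ℓ : D, nuI ν ℓ.1

/-- `λ_D(ν) = max_i sup_{ℓ,ℓ' ∈ D} ν(I_ℓ H^i_{ℓ'})`. -/
def lamD [MeasurableSpace Ξ] (h : Ξ → ℝ) (ν : Measure ((L → Ξ) × (L → Ξ))) (D : Set L) : ℝ≥0∞ :=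
  ⨆ i : Fin 2, ⨆ ℓ : D, ⨆ ℓ' : D, nuIH h ν i ℓ.1 ℓ'.1

/-- The reconstruction map `R_ℓ` built from a family of couplings `ϱ`. -/
def Rmap [MeasurableSpace Ξ] (ϱ : L → (L → Ξ) → (L → Ξ) → Measure (Ξ × Ξ))
    (ℓ : L) (ν : Measure ((L → Ξ) × (L → Ξ))) : Measure ((L → Ξ) × (L → Ξ)) :=
  ν.bind fun p =>
    (ϱ ℓ p.1 p.2).map fun q => (Function.update p.1 ℓ q.1, Function.update p.2 ℓ q.2)

/-- A jointly measurable family of optimal couplings of `π ℓ x` and `π ℓ y`. -/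
structure OptCoupling [MeasurableSpace Ξ] (π : L → (L → Ξ) → Measure Ξ)
    (ϱ : L → (L → Ξ) → (L → Ξ) → Measure (Ξ × Ξ)) : Prop where
  coupling : ∀ ℓ x y, IsCoupling (ϱ ℓ x y) (π ℓ x) (π ℓ y)
  meas : ∀ (ℓ : L) (B : Set (Ξ × Ξ)), MeasurableSet B →
    Measurable[FlocPair ℓ] fun p : (L → Ξ) × (L → Ξ) => ϱ ℓ p.1 p.2 B
  opt : ∀ ℓ x y, ENNReal.ofReal (tvDist (π ℓ x) (π ℓ y)) = ∫⁻ q, ups q.1 q.2 ∂(ϱ ℓ x y)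

/-- The constant `A = 2Δ^{χ+1}/(1-κ̄)`. -/
def Abar (Δ χ : ℕ) (κb : ℝ) : ℝ := 2 * (Δ : ℝ) ^ (χ + 1) / (1 - κb)

/-- The threshold `K_*`. -/
def Kstar (Δ χ : ℕ) (κb cb : ℝ) : ℝ :=
  max (4 * (Δ : ℝ) ^ (χ + 1) / (cb * (1 - κb)))
    (2 * (Δ : ℝ) ^ (χ + 1) * (2 * (Δ : ℝ) ^ (χ - 1) + 1 - cb * (Δ : ℝ) ^ χ) /
      ((1 - κb) ^ 2 * (1 - cb * (Δ : ℝ) ^ χ)))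

/-- The spectral radius `r_K` of the matrix `M(K)`. -/
def rK (Δ χ : ℕ) (κb cb K : ℝ) : ℝ :=
  (κb + Abar Δ χ κb / K + cb * (Δ : ℝ) ^ χ +
    Real.sqrt ((κb + Abar Δ χ κb / K - cb * (Δ : ℝ) ^ χ) ^ 2 +
      8 * (Δ : ℝ) ^ χ * (Abar Δ χ κb / K))) / 2

/-- The matrix `M(K)` with entries in `ℝ≥0∞`. -/
def MK (Δ χ : ℕ) (κb cb K : ℝ) : Matrix (Fin 2) (Fin 2) ℝ≥0∞ :=
  !![ENNReal.ofReal (κb + Abar Δ χ κb / K), ENNReal.ofReal (2 * Abar Δ χ κb / K);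
     ENNReal.ofReal ((Δ : ℝ) ^ (χ - 1)), ENNReal.ofReal (cb * (Δ : ℝ) ^ χ)]

/-- The class `Π(h,K,κ,c)` of one-site specifications, with `κ̄ ≤ κb`, `c̄ ≤ cb`
understood via the separate hypotheses on `κb`, `cb`. -/
structure InPi [MeasurableSpace Ξ] (G : SimpleGraph L) [∀ v, Fintype (G.neighborSet v)]
    (π : L → (L → Ξ) → Measure Ξ) (h : Ξ → ℝ) (K : ℝ) (κ c : L → L → ℝ) : Prop where
  spec : IsSpecification π
  tv_bound : ∀ (ℓ : L) (x y : L → Ξ),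
    (∀ ℓ' ∈ G.neighborFinset ℓ, h (x ℓ') ≤ K) →
    (∀ ℓ' ∈ G.neighborFinset ℓ, h (y ℓ') ≤ K) →
    tvDist (π ℓ x) (π ℓ y) ≤ ∑ ℓ' ∈ G.neighborFinset ℓ, κ ℓ ℓ' * upsR (x ℓ') (y ℓ')
  h_bound : ∀ (ℓ : L) (x : L → Ξ),
    ∫⁻ ξ, ENNReal.ofReal (h ξ) ∂(π ℓ x) ≤
      ENNReal.ofReal (1 + ∑ ℓ' ∈ G.neighborFinset ℓ, c ℓ ℓ' * h (x ℓ'))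

end
end DP

namespace DP

open ProbabilityTheory

/-- The coupling of `c + a` and `c + b` that puts `c` on the diagonal and couples `a` and `b`
independently, normalised by their common mass. -/
noncomputable def maximalCoupling {E : Type*} [MeasurableSpace E] (c a b : Measure E) :
    Measure (E × E) :=
  c.map (fun x => (x, x)) + (a Set.univ)⁻¹ • a.prod b

section Measures

variable {E : Type*} [MeasurableSpace E] {a b c : Measure E}

lemma isCoupling_maximalCoupling [IsFiniteMeasure a] [IsFiniteMeasure b]
    (h : a Set.univ = b Set.univ) :
    IsCoupling (maximalCoupling c a b) (c + a) (c + b) := by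
  have hd : Measurable fun x : E => (x, x) := by fun_prop
  rcases eq_or_ne (a Set.univ) 0 with h0 | h0
  · have ha : a = 0 := Measure.measure_univ_eq_zero.mp h0
    have hb : b = 0 := Measure.measure_univ_eq_zero.mp (h ▸ h0)
    subst ha hb
    constructor <;>
      simp [maximalCoupling, Measure.map_map measurable_fst hd, Measure.map_map measurable_snd hd,
        Function.comp_def]
  · have hfin : a Set.univ ≠ ∞ := measure_ne_top _ _
    constructor
    · rw [maximalCoupling, Measure.map_add _ _ measurable_fst, Measure.map_smul,
        Measure.map_map measurable_fst hd, Measure.map_fst_prod, ← h, smul_smul,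
        ENNReal.inv_mul_cancel h0 hfin, one_smul]
      simp [Function.comp_def]
    · rw [maximalCoupling, Measure.map_add _ _ measurable_snd, Measure.map_smul,
        Measure.map_map measurable_snd hd, Measure.map_snd_prod, smul_smul,
        ENNReal.inv_mul_cancel h0 hfin, one_smul]
      simp [Function.comp_def]

lemma lintegral_ups_maximalCoupling [MeasurableEq E] [IsFiniteMeasure a] [IsFiniteMeasure b]
    (h : a Set.univ = b Set.univ) {A : Set E} (haA : a Aᶜ = 0) (hbA : b A = 0) :
    ∫⁻ q, ups q.1 q.2 ∂(maximalCoupling c a b) = a Set.univ := by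
  have hd : Measurable fun x : E => (x, x) := by fun_prop
  have hD : MeasurableSet {q : E × E | q.1 = q.2} := 
    measurableSet_eq_fun measurable_fst measurable_snd
  have hu : Measurable fun q : E × E => ups q.1 q.2 :=
    Measurable.ite hD measurable_const measurable_const
  have hdiag : ∀ᵐ q ∂(a.prod b), ups q.1 q.2 = 1 := by
    have h1 : (a.prod b) (Aᶜ ×ˢ Set.univ) = 0 := by rw [Measure.prod_prod, haA, zero_mul]
    have h2 : (a.prod b) (Set.univ ×ˢ A) = 0 := by rw [Measure.prod_prod, hbA, mul_zero]
    refine measure_mono_null (fun q hq => ?_) (measure_union_null h1 h2)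
    have hq' : q.1 = q.2 := by
      by_contra hne
      exact hq (if_neg hne)
    by_cases hA : q.1 ∈ A
    · exact Or.inr ⟨trivial, hq' ▸ hA⟩
    · exact Or.inl ⟨hA, trivial⟩
  rw [maximalCoupling, lintegral_add_measure, lintegral_map hu hd, lintegral_smul_measure,
    lintegral_congr_ae hdiag, lintegral_one, ← Set.univ_prod_univ, Measure.prod_prod, ← h]
  rcases eq_or_ne (a Set.univ) 0 with h0 | h0
  · simp [ups, h0]
  · simp [ups, ← mul_assoc, ENNReal.inv_mul_cancel h0 (measure_ne_top _ _)]

lemma tvDist_add_eq [IsFiniteMeasure a] [IsFiniteMeasure b] [IsFiniteMeasure c]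
    (h : a Set.univ = b Set.univ) {A : Set E} (hA : MeasurableSet A)
    (haA : a Aᶜ = 0) (hbA : b A = 0) :
    tvDist (c + a) (c + b) = (a Set.univ).toReal := by
  have hdiff (B : Set E) :
      ((c + a) B).toReal - ((c + b) B).toReal = (a B).toReal - (b B).toReal := by
    rw [Measure.add_apply, Measure.add_apply,
      ENNReal.toReal_add (measure_ne_top _ _) (measure_ne_top _ _),
      ENNReal.toReal_add (measure_ne_top _ _) (measure_ne_top _ _)]
    ring
  have hle (B : {B : Set E // MeasurableSet B}) :
      |((c + a) B.1).toReal - ((c + b) B.1).toReal| ≤ (a Set.univ).toReal := by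
    have h1 : (a B.1).toReal ≤ (a Set.univ).toReal :=
      ENNReal.toReal_mono (measure_ne_top _ _) (measure_mono (Set.subset_univ _))
    have h2 : (b B.1).toReal ≤ (a Set.univ).toReal :=
      h ▸ ENNReal.toReal_mono (measure_ne_top _ _) (measure_mono (Set.subset_univ _))
    rw [hdiff, abs_le]
    constructor <;> linarith [(a B.1).toReal_nonneg, (b B.1).toReal_nonneg]
  have : Nonempty {B : Set E // MeasurableSet B} := ⟨⟨A, hA⟩⟩
  refine le_antisymm (ciSup_le hle) ?_
  refine le_ciSup_of_le ⟨_, Set.forall_mem_range.mpr hle⟩ ⟨A, hA⟩ ?_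
  have haA' : a A = a Set.univ := by
    rw [← measure_add_measure_compl hA, haA, add_zero]
  rw [hdiff, haA', hbA]
  simp

end Measures

section Kernels

variable {α E : Type*} [MeasurableSpace α] [MeasurableSpace E]

lemma measurable_maximalCoupling (c a b : Kernel α E) [IsSFiniteKernel a] [IsSFiniteKernel b]
    {B : Set (E × E)} (hB : MeasurableSet B) :
    Measurable fun p => maximalCoupling (c p) (a p) (b p) B := by
  have hd : Measurable fun x : E => (x, x) := by fun_prop
  simp only [maximalCoupling, Measure.add_apply, Measure.smul_apply, smul_eq_mul,
    Measure.map_apply hd hB, ← Kernel.prod_apply]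
  exact (c.measurable_coe (hd hB)).add
    ((a.measurable_coe MeasurableSet.univ).inv.mul ((a.prod b).measurable_coe hB))

/-- Two finite kernels decompose measurably as a common part plus mutually singular excesses. -/
lemma exists_common_part [MeasurableSpace.CountableOrCountablyGenerated α E]
    (κ η : Kernel α E) [IsFiniteKernel κ] [IsFiniteKernel η] :
    ∃ c a b : Kernel α E, κ = c + a ∧ η = c + b ∧
      ∀ p, ∃ A, MeasurableSet A ∧ a p Aᶜ = 0 ∧ b p A = 0 := by
  let ζ := κ + η
  let f := Kernel.rnDeriv κ ζ
  let g := Kernel.rnDeriv η ζ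
  have hf : Measurable (Function.uncurry f) := Kernel.measurable_rnDeriv κ ζ
  have hg : Measurable (Function.uncurry g) := Kernel.measurable_rnDeriv η ζ
  have hm : Measurable (Function.uncurry fun p x => min (f p x) (g p x)) := hf.min hg
  have ha : Measurable (Function.uncurry fun p x => f p x - g p x) := hf.sub hg
  have hb : Measurable (Function.uncurry fun p x => g p x - f p x) := hg.sub hf
  have hκ : κ = ζ.withDensity f := by
    ext1 p
    refine (Kernel.withDensity_rnDeriv_eq ?_).symm
    exact Measure.absolutelyContinuous_of_le (Measure.le_add_right le_rfl)
  have hη : η = ζ.withDensity g := by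
    ext1 p
    refine (Kernel.withDensity_rnDeriv_eq ?_).symm
    exact Measure.absolutelyContinuous_of_le (Measure.le_add_left le_rfl)
  refine ⟨ζ.withDensity fun p x => min (f p x) (g p x), ζ.withDensity fun p x => f p x - g p x,
    ζ.withDensity fun p x => g p x - f p x, ?_, ?_, fun p => ⟨{x | g p x < f p x}, ?_, ?_, ?_⟩⟩
  · rw [← Kernel.withDensity_add_right hm ha]
    refine hκ.trans (congrArg _ ?_)
    ext p x
    simp [add_comm, tsub_add_min]
  · rw [← Kernel.withDensity_add_right hm hb]
    refine hη.trans (congrArg _ ?_)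
    ext p x
    simp [add_comm, min_comm (f p x), tsub_add_min]
  · exact measurableSet_lt hg.of_uncurry_left hf.of_uncurry_left
  · rw [Kernel.withDensity_apply' _ ha]
    refine setLIntegral_eq_zero
      (measurableSet_lt hg.of_uncurry_left hf.of_uncurry_left).compl fun x hx => ?_
    exact tsub_eq_zero_of_le (not_lt.mp hx)
  · rw [Kernel.withDensity_apply' _ hb]
    refine setLIntegral_eq_zero
      (measurableSet_lt hg.of_uncurry_left hf.of_uncurry_left) fun x hx => ?_
    exact tsub_eq_zero_of_le (le_of_lt hx)

/-- Two Markov kernels admit a measurable family of optimal couplings. -/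
lemma exists_measurable_maximal_coupling [MeasurableEq E]
    [MeasurableSpace.CountableOrCountablyGenerated α E]
    (κ η : Kernel α E) [IsMarkovKernel κ] [IsMarkovKernel η] :
    ∃ ϱ : α → Measure (E × E), (∀ p, IsCoupling (ϱ p) (κ p) (η p)) ∧
      (∀ B, MeasurableSet B → Measurable fun p => ϱ p B) ∧
      ∀ p, ENNReal.ofReal (tvDist (κ p) (η p)) = ∫⁻ q, ups q.1 q.2 ∂(ϱ p) := by
  obtain ⟨c, a, b, hκ, hη, hsing⟩ := exists_common_part κ η
  have hκp (p : α) : κ p = c p + a p := by rw [hκ, _root_.add_apply]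
  have hηp (p : α) : η p = c p + b p := by rw [hη, _root_.add_apply]
  have : IsFiniteKernel c := isFiniteKernel_of_le (ν := κ) fun p => by
    rw [hκp]; exact Measure.le_add_right le_rfl
  have : IsFiniteKernel a := isFiniteKernel_of_le (ν := κ) fun p => by
    rw [hκp]; exact Measure.le_add_left le_rfl
  have : IsFiniteKernel b := isFiniteKernel_of_le (ν := η) fun p => by
    rw [hηp]; exact Measure.le_add_left le_rfl
  have hmass (p : α) : a p Set.univ = b p Set.univ := by
    have h1 : c p Set.univ + a p Set.univ = 1 := by
      rw [← Measure.add_apply, ← hκp, measure_univ]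
    have h2 : c p Set.univ + b p Set.univ = 1 := by
      rw [← Measure.add_apply, ← hηp, measure_univ]
    exact (ENNReal.add_right_inj (measure_ne_top _ _)).mp (h1.trans h2.symm)
  refine ⟨fun p => maximalCoupling (c p) (a p) (b p), fun p => ?_,
    fun B hB => measurable_maximalCoupling c a b hB, fun p => ?_⟩
  · rw [hκp, hηp]
    exact isCoupling_maximalCoupling (hmass p)
  · obtain ⟨A, hA, haA, hbA⟩ := hsing p
    rw [hκp, hηp, tvDist_add_eq (hmass p) hA haA hbA,
      lintegral_ups_maximalCoupling (hmass p) haA hbA, ENNReal.ofReal_toReal (measure_ne_top _ _)]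

end Kernels

end DP

/-- existence of a jointly measurable family of optimal couplings
realizing the total variation distance. -/
theorem exists_measurable_optimal_coupling {L Ξ : Type*} [Countable L]
    [MeasurableSpace Ξ] [StandardBorelSpace Ξ] (π : L → (L → Ξ) → Measure Ξ)
    (hπ : DP.IsSpecification π) (ℓ : L) :
    ∃ ϱ : (L → Ξ) → (L → Ξ) → Measure (Ξ × Ξ),
      (∀ x y, DP.IsCoupling (ϱ x y) (π ℓ x) (π ℓ y)) ∧
      (∀ B : Set (Ξ × Ξ), MeasurableSet B →
        Measurable[DP.FlocPair ℓ] fun p : (L → Ξ) × (L → Ξ) => ϱ p.1 p.2 B) ∧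
      (∀ x y, ENNReal.ofReal (DP.tvDist (π ℓ x) (π ℓ y)) =
        ∫⁻ q, DP.ups q.1 q.2 ∂(ϱ x y)) := by
  let _ : MeasurableSpace ((L → Ξ) × (L → Ξ)) := DP.FlocPair ℓ
  have hfst : Measurable[DP.FlocPair ℓ, DP.Floc ℓ] (Prod.fst : (L → Ξ) × (L → Ξ) → L → Ξ) :=
    measurable_iff_comap_le.mpr le_sup_left
  have hsnd : Measurable[DP.FlocPair ℓ, DP.Floc ℓ] (Prod.snd : (L → Ξ) × (L → Ξ) → L → Ξ) :=
    measurable_iff_comap_le.mpr le_sup_right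
  let κ : ProbabilityTheory.Kernel ((L → Ξ) × (L → Ξ)) Ξ :=
    ⟨fun p => π ℓ p.1, Measure.measurable_of_measurable_coe _
      fun A hA => (hπ.meas ℓ A hA).comp hfst⟩
  let η : ProbabilityTheory.Kernel ((L → Ξ) × (L → Ξ)) Ξ :=
    ⟨fun p => π ℓ p.2, Measure.measurable_of_measurable_coe _
      fun A hA => (hπ.meas ℓ A hA).comp hsnd⟩
  have : ProbabilityTheory.IsMarkovKernel κ := ⟨fun p => hπ.prob ℓ p.1⟩
  have : ProbabilityTheory.IsMarkovKernel η := ⟨fun p => hπ.prob ℓ p.2⟩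
  obtain ⟨ϱ, hc, hm, ho⟩ := DP.exists_measurable_maximal_coupling κ η
  exact ⟨fun x y => ϱ (x, y), fun x y => hc (x, y), hm, fun x y => ho (x, y)⟩
end

section
/- Let π be a one-site specification on X = Ξ^L and let ϖ = (ϖ_ℓ^{x,y})_{ℓ∈L,(x,y)∈X²} be a family of probability measures on Ξ² such that for each ℓ and each B ∈ B(Ξ²) the map (x,y) ↦ ϖ_ℓ^{x,y}(B) is (F_ℓ ⊗ F_ℓ)-measurable, and such that ϖ_ℓ^{x,x̃} ∈ C(π_ℓ^x, π_ℓ^{x̃}) for all ℓ ∈ L and x, x̃ ∈ X. Then every probability measure ν on X² that is consistent with ϖ (viewed as a one-site specification on the doubled configuration space (Ξ×Ξ)^L) is a coupling of two measures μ1, μ2 ∈ M(π); that is, its two X-marginals are each consistent with π. -/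
open MeasureTheory ENNReal Filter
open scoped Classical ENNReal

/-- Consistency of a measure on `X²` with a family `ϖ` of measures on `Ξ²`,
viewed as a one-site specification on the doubled configuration space. -/
def Consistent2 {L Ξ : Type*} [MeasurableSpace Ξ]
    (ϖ : L → (L → Ξ) → (L → Ξ) → Measure (Ξ × Ξ))
    (ν : Measure ((L → Ξ) × (L → Ξ))) : Prop :=
  ∀ (ℓ : L) (B : Set ((L → Ξ) × (L → Ξ))), MeasurableSet B →
    ν B = ∫⁻ p, ϖ ℓ p.1 p.2
      {q : Ξ × Ξ | (Function.update p.1 ℓ q.1, Function.update p.2 ℓ q.2) ∈ B} ∂ν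

theorem DP.Floc_le {L Ξ : Type*} [MeasurableSpace Ξ] (ℓ : L) :
    DP.Floc (Ξ := Ξ) ℓ ≤ MeasurableSpace.pi :=
  Measurable.comap_le (measurable_pi_lambda _ fun i => measurable_pi_apply i.1)

theorem DP.measurable_update_prod {L Ξ : Type*} [MeasurableSpace Ξ] (ℓ : L) :
    Measurable fun p : (L → Ξ) × Ξ => Function.update p.1 ℓ p.2 :=
  measurable_update'

/-- The probability that resampling the site `ℓ` lands in `A` depends measurably on the
configuration. -/
theorem DP.IsSpecification.measurable_update_apply {L Ξ : Type*} [MeasurableSpace Ξ]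
    {π : L → (L → Ξ) → Measure Ξ} (hπ : DP.IsSpecification π) (ℓ : L) {A : Set (L → Ξ)}
    (hA : MeasurableSet A) :
    Measurable fun y => π ℓ y {ξ : Ξ | Function.update y ℓ ξ ∈ A} := by
  let κ : ProbabilityTheory.Kernel (L → Ξ) Ξ :=
    ⟨π ℓ, Measure.measurable_of_measurable_coe _ fun s hs =>
      (hπ.meas ℓ s hs).mono (DP.Floc_le ℓ) le_rfl⟩
  haveI : ProbabilityTheory.IsMarkovKernel κ := ⟨fun x => hπ.prob ℓ x⟩
  exact ProbabilityTheory.Kernel.measurable_kernel_prodMk_left (κ := κ)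
    (DP.measurable_update_prod ℓ hA)

/-- if `ϖ_ℓ^{x,xt}` is a measurable family of couplings of
`π_ℓ^x`, `π_ℓ^{xt}`, then any `ν` consistent with `ϖ` is a coupling of two
measures consistent with `π`; i.e. both marginals of `ν` are consistent with `π`. -/
theorem marginals_consistent {L Ξ : Type*} [Countable L] [MeasurableSpace Ξ]
    [StandardBorelSpace Ξ] (π : L → (L → Ξ) → Measure Ξ) (hπ : DP.IsSpecification π)
    (ϖ : L → (L → Ξ) → (L → Ξ) → Measure (Ξ × Ξ))
    (hϖmeas : ∀ (ℓ : L) (B : Set (Ξ × Ξ)), MeasurableSet B →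
      Measurable[DP.FlocPair ℓ] fun p : (L → Ξ) × (L → Ξ) => ϖ ℓ p.1 p.2 B)
    (hϖc : ∀ (ℓ : L) (x xt : L → Ξ), DP.IsCoupling (ϖ ℓ x xt) (π ℓ x) (π ℓ xt))
    (ν : Measure ((L → Ξ) × (L → Ξ))) [IsProbabilityMeasure ν]
    (hν : Consistent2 ϖ ν) :
    DP.Consistent π (ν.map Prod.fst) ∧ DP.Consistent π (ν.map Prod.snd) := by
  have hslice : ∀ (ℓ : L) (y : L → Ξ) {A : Set (L → Ξ)}, MeasurableSet A →
      MeasurableSet {ξ : Ξ | Function.update y ℓ ξ ∈ A} := fun ℓ y A hA =>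
    (DP.measurable_update_prod ℓ).comp measurable_prodMk_left hA
  constructor
  · intro ℓ A hA
    rw [Measure.map_apply measurable_fst hA, hν ℓ _ (measurable_fst hA),
      lintegral_map (hπ.measurable_update_apply ℓ hA) measurable_fst]
    refine lintegral_congr fun p => ?_
    rw [← (hϖc ℓ p.1 p.2).1, Measure.map_apply measurable_fst (hslice ℓ p.1 hA)]
    rfl
  · intro ℓ A hA
    rw [Measure.map_apply measurable_snd hA, hν ℓ _ (measurable_snd hA),
      lintegral_map (hπ.measurable_update_apply ℓ hA) measurable_snd]
    refine lintegral_congr fun p => ?_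
    rw [← (hϖc ℓ p.1 p.2).2, Measure.map_apply measurable_snd (hslice ℓ p.2 hA)]
    rfl
end

section
/- For every ℓ ∈ L: if ν ∈ C(μ1, μ2) for some μ1, μ2 ∈ M(π), then also R_ℓν ∈ C(μ1, μ2). -/
open MeasureTheory ENNReal Filter
open scoped Classical ENNReal

namespace DP

/-- Pushing a measurable family of finite measures forward along a jointly measurable map
yields a measurable family. -/
theorem measurable_map_prodMk {α β γ : Type*} [MeasurableSpace α] [MeasurableSpace β]
    [MeasurableSpace γ] {κ : α → Measure β} (hκ : Measurable κ)
    (hfin : ∀ a, IsFiniteMeasure (κ a)) {g : α × β → γ} (hg : Measurable g) :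
    Measurable fun a => (κ a).map fun b => g (a, b) := by
  refine Measure.measurable_of_measurable_coe _ fun s hs => ?_
  have hmap : ∀ a, (κ a).map (fun b => g (a, b)) s = κ a (Prod.mk a ⁻¹' (g ⁻¹' s)) := fun a =>
    Measure.map_apply (hg.comp measurable_prodMk_left) hs
  simp_rw [hmap]
  exact ProbabilityTheory.Kernel.measurable_kernel_prodMk_left_of_finite
    (κ := ⟨κ, hκ⟩) (hg hs) hfin

variable {L Ξ : Type*} [MeasurableSpace Ξ]

theorem Floc_le_s7 (ℓ : L) : Floc (Ξ := Ξ) ℓ ≤ MeasurableSpace.pi :=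
  (measurable_pi_lambda _ fun i => measurable_pi_apply i.1).comap_le

theorem FlocPair_le (ℓ : L) :
    FlocPair (Ξ := Ξ) ℓ ≤ (inferInstance : MeasurableSpace ((L → Ξ) × (L → Ξ))) :=
  sup_le_sup (MeasurableSpace.comap_mono (Floc_le_s7 ℓ)) (MeasurableSpace.comap_mono (Floc_le_s7 ℓ))

theorem IsSpecification.measurable {π : L → (L → Ξ) → Measure Ξ} (hπ : IsSpecification π)
    (ℓ : L) : Measurable (π ℓ) :=
  Measure.measurable_of_measurable_coe _ fun A hA => (hπ.meas ℓ A hA).mono (Floc_le_s7 ℓ) le_rfl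

theorem OptCoupling.measurable {π : L → (L → Ξ) → Measure Ξ}
    {ϱ : L → (L → Ξ) → (L → Ξ) → Measure (Ξ × Ξ)} (hϱ : OptCoupling π ϱ) (ℓ : L) :
    Measurable fun p : (L → Ξ) × (L → Ξ) => ϱ ℓ p.1 p.2 :=
  Measure.measurable_of_measurable_coe _ fun B hB =>
    (hϱ.meas ℓ B hB).mono (FlocPair_le ℓ) le_rfl

theorem OptCoupling.isProbabilityMeasure {π : L → (L → Ξ) → Measure Ξ}
    {ϱ : L → (L → Ξ) → (L → Ξ) → Measure (Ξ × Ξ)} (hϱ : OptCoupling π ϱ)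
    (hπ : IsSpecification π) (ℓ : L) (x y : L → Ξ) : IsProbabilityMeasure (ϱ ℓ x y) := by
  have := hπ.prob ℓ x
  rw [← (hϱ.coupling ℓ x y).1] at this
  exact Measure.isProbabilityMeasure_of_map Prod.fst

/-- A consistent measure is invariant under resampling the coordinate `ℓ`. -/
theorem Consistent.bind_update {π : L → (L → Ξ) → Measure Ξ} (hπ : IsSpecification π)
    {μ : Measure (L → Ξ)} (hμ : Consistent π μ) (ℓ : L) :
    (μ.bind fun x => (π ℓ x).map (Function.update x ℓ)) = μ := by
  have hm : Measurable fun x : L → Ξ => (π ℓ x).map (Function.update x ℓ) :=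
    measurable_map_prodMk (hπ.measurable ℓ) (fun x => have := hπ.prob ℓ x; inferInstance)
      measurable_update'
  ext A hA
  rw [Measure.bind_apply hA hm.aemeasurable, hμ ℓ A hA]
  exact lintegral_congr fun x => Measure.map_apply (measurable_update x) hA

/-- If a coordinate projection `f` of `X²` intertwines the simultaneous update with the update of
a single configuration, then `R_ℓ` preserves a consistent `f`-marginal. -/
theorem map_Rmap {π : L → (L → Ξ) → Measure Ξ} (hπ : IsSpecification π)
    {ϱ : L → (L → Ξ) → (L → Ξ) → Measure (Ξ × Ξ)} (hϱ : OptCoupling π ϱ) (ℓ : L)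
    {μ : Measure (L → Ξ)} (hμ : Consistent π μ) {ν : Measure ((L → Ξ) × (L → Ξ))}
    {f : (L → Ξ) × (L → Ξ) → L → Ξ} {g : Ξ × Ξ → Ξ} (hf : Measurable f) (hg : Measurable g)
    (hν : ν.map f = μ) (hmap : ∀ p, (ϱ ℓ p.1 p.2).map g = π ℓ (f p))
    (hfg : ∀ p q, f (Function.update p.1 ℓ q.1, Function.update p.2 ℓ q.2) =
      Function.update (f p) ℓ (g q)) :
    (Rmap ϱ ℓ ν).map f = μ := by
  have hu : Measurable fun z : ((L → Ξ) × (L → Ξ)) × (Ξ × Ξ) =>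
      (Function.update z.1.1 ℓ z.2.1, Function.update z.1.2 ℓ z.2.2) :=
    (measurable_update'.comp (by fun_prop : Measurable
      fun z : ((L → Ξ) × (L → Ξ)) × (Ξ × Ξ) => (z.1.1, z.2.1))).prodMk
    (measurable_update'.comp (by fun_prop : Measurable
      fun z : ((L → Ξ) × (L → Ξ)) × (Ξ × Ξ) => (z.1.2, z.2.2)))
  have hR := measurable_map_prodMk (hϱ.measurable ℓ)
    (fun p => have := hϱ.isProbabilityMeasure hπ ℓ p.1 p.2; inferInstance) hu
  have hm : Measurable fun x : L → Ξ => (π ℓ x).map (Function.update x ℓ) :=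
    measurable_map_prodMk (hπ.measurable ℓ) (fun x => have := hπ.prob ℓ x; inferInstance)
      measurable_update'
  conv_rhs => rw [← hμ.bind_update hπ ℓ, ← hν]
  ext A hA
  rw [Measure.map_apply hf hA, Rmap, Measure.bind_apply (hf hA) hR.aemeasurable,
    Measure.bind_apply hA hm.aemeasurable, lintegral_map ((Measure.measurable_coe hA).fun_comp hm) hf]
  refine lintegral_congr fun p => ?_
  rw [← hmap p, Measure.map_map (measurable_update _) hg, ← Measure.map_apply hf hA,
    Measure.map_map hf (hu.fun_comp measurable_prodMk_left)]
  congr 2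
  exact funext fun q => hfg p q

end DP

/-- the reconstruction map `R_ℓ` preserves the property of being a
coupling of `μ1, μ2 ∈ M(π)`. -/
theorem Rmap_isCoupling {L Ξ : Type*} [Countable L] [MeasurableSpace Ξ]
    [StandardBorelSpace Ξ] (π : L → (L → Ξ) → Measure Ξ) (hπ : DP.IsSpecification π)
    (ϱ : L → (L → Ξ) → (L → Ξ) → Measure (Ξ × Ξ)) (hϱ : DP.OptCoupling π ϱ)
    (μ1 μ2 : Measure (L → Ξ)) [IsProbabilityMeasure μ1] [IsProbabilityMeasure μ2]
    (h1 : DP.Consistent π μ1) (h2 : DP.Consistent π μ2)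
    (ν : Measure ((L → Ξ) × (L → Ξ))) (hc : DP.IsCoupling ν μ1 μ2) (ℓ : L) :
    DP.IsCoupling (DP.Rmap ϱ ℓ ν) μ1 μ2 := by
  exact ⟨DP.map_Rmap hπ hϱ ℓ h1 measurable_fst measurable_fst hc.1
      (fun p => (hϱ.coupling ℓ p.1 p.2).1) fun _ _ => rfl,
    DP.map_Rmap hπ hϱ ℓ h2 measurable_snd measurable_snd hc.2
      (fun p => (hϱ.coupling ℓ p.1 p.2).2) fun _ _ => rfl⟩
end
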